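/- Let N ≥ 3 and σ ∈ (0, N). For α ∈ (0,1) let c(σ,α) = c_{N,α} · (-(1/2)) ∫_{ℝ^N} (|z+e_N|^{-σ} + |z-e_N|^{-σ} - 2)/|z|^{N+2α} dz, where c_{N,α} = (∫(1-cos z₁)|z|^{-N-2α}dz)^{-1}. Then lim_{α→1⁻} c(σ,α) = (N - 2 - σ)·σ. -/

import Mathlib

open MeasureTheory Metric Filter Real Set

theorem rpow_one_add_sub_taylor_isBigO (p : ℝ) :
    (fun t : ℝ => (1 + t) ^ p - (1 + p * t + p * (p - 1) / 2 * t ^ 2)) =O[nhds 0]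
      fun t => |t| ^ 3 := by
  have h := (Real.one_add_rpow_hasFPowerSeriesAt_zero (a := p)).isBigO_sub_partialSum_pow 3
  refine h.congr_left fun t => ?_
  simp [FormalMultilinearSeries.partialSum, Finset.sum_range_succ, binomialSeries,
    Ring.choose_eq_smul, descPochhammer_succ_right, Polynomial.smeval_mul, Polynomial.smeval_sub]
  ring

section
variable {E : Type*} [NormedAddCommGroup E] [NormedSpace ℝ E] [FiniteDimensional ℝ E]
  [Nontrivial E] [MeasurableSpace E] [BorelSpace E] (μ : Measure E) [μ.IsAddHaarMeasure]

theorem integrableOn_ball_norm_rpow {s r : ℝ} (hs : -(Module.finrank ℝ E : ℝ) < s) :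
    IntegrableOn (fun x : E => ‖x‖ ^ s) (ball 0 r) μ := by
  exact integrableOn_ball_of_norm_le_rpow (C := 1) (α := -s) Module.finrank_pos (by linarith)
    (.of_forall fun x => by simp [abs_of_nonneg (rpow_nonneg (norm_nonneg x) s)])
    (Measurable.aestronglyMeasurable (by fun_prop))

theorem setIntegral_ball_norm_rpow {s : ℝ} (hs : -(Module.finrank ℝ E : ℝ) < s) :
    ∫ x in ball (0 : E) 1, ‖x‖ ^ s ∂μ =
      Module.finrank ℝ E * μ.real (ball 0 1) / (Module.finrank ℝ E + s) := by
  have hn : 0 < Module.finrank ℝ E := Module.finrank_pos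
  have e : ∫ x in ball (0 : E) 1, ‖x‖ ^ s ∂μ
      = ∫ x, (Iio 1).indicator (fun y : ℝ => y ^ s) ‖x‖ ∂μ := by
    rw [← integral_indicator measurableSet_ball]
    congr with x
    by_cases hx : ‖x‖ < 1 <;> simp [hx]
  have e2 : ∫ y in Ioi (0 : ℝ),
      y ^ (Module.finrank ℝ E - 1) • (Iio 1).indicator (fun y : ℝ => y ^ s) y
      = 1 / (Module.finrank ℝ E + s) := by
    have : ∀ y ∈ Ioi (0 : ℝ),
        y ^ (Module.finrank ℝ E - 1) • (Iio 1).indicator (fun y : ℝ => y ^ s) y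
        = (Iio 1).indicator (fun y : ℝ => y ^ ((Module.finrank ℝ E : ℝ) - 1 + s)) y := by
      intro y hy
      by_cases h : y < 1
      · simp only [smul_eq_mul, mem_Iio, h, indicator_of_mem]
        rw [rpow_add hy, ← Nat.cast_pred hn, rpow_natCast]
      · simp [h]
    rw [setIntegral_congr_fun measurableSet_Ioi this, setIntegral_indicator measurableSet_Iio,
      Ioi_inter_Iio, ← integral_Ioc_eq_integral_Ioo, ← intervalIntegral.integral_of_le zero_le_one,
      integral_rpow (by left; linarith), one_rpow, zero_rpow (by linarith)]
    ring
  rw [e, integral_fun_norm_addHaar μ, e2]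
  simp [Measure.real]
  ring
end

theorem setIntegral_ball_coord_sq_mul (N : ℕ) (i j : Fin N) (f : ℝ → ℝ) :
    ∫ z in ball (0 : EuclideanSpace ℝ (Fin N)) 1, z i ^ 2 * f ‖z‖ =
      ∫ z in ball (0 : EuclideanSpace ℝ (Fin N)) 1, z j ^ 2 * f ‖z‖ := by
  let L := LinearIsometryEquiv.piLpCongrLeft 2 ℝ ℝ (Equiv.swap i j)
  have hp := L.measurePreserving.setIntegral_preimage_emb L.toHomeomorph.measurableEmbedding
    (fun z => z j ^ 2 * f ‖z‖) (ball 0 1)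
  rw [← hp]
  have : L ⁻¹' ball 0 1 = ball 0 1 := by ext; simp
  rw [this]
  congr with z
  simp [L]

section
variable {N : ℕ}

theorem norm_sq_mul_rpow_neg {E : Type*} [SeminormedAddCommGroup E] (z : E) {p : ℝ} (hp : 2 < p) :
    ‖z‖ ^ 2 * ‖z‖ ^ (-p) = ‖z‖ ^ (2 - p) := by
  rcases (norm_nonneg z).eq_or_lt with h | h
  · rw [← h, zero_rpow (by linarith), zero_rpow (by linarith), mul_zero]
  · rw [sub_eq_add_neg, rpow_add h, rpow_two]

theorem setIntegral_ball_norm_sq_mul_rpow (i : Fin N) {p : ℝ} (hp : N + 1 < p) (hp' : p < N + 2) :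
    ∫ z in ball (0 : EuclideanSpace ℝ (Fin N)) 1, ‖z‖ ^ 2 * ‖z‖ ^ (-p) =
      N * volume.real (ball (0 : EuclideanSpace ℝ (Fin N)) 1) / (N + 2 - p) := by
  have : Nonempty (Fin N) := ⟨i⟩
  have hN : (1 : ℝ) ≤ N := by exact_mod_cast Fin.pos i
  simp_rw [norm_sq_mul_rpow_neg _ (show 2 < p by linarith)]
  rw [setIntegral_ball_norm_rpow volume (by simp; linarith)]
  simp [add_sub_assoc]

theorem integrableOn_ball_norm_sq_mul_rpow (i : Fin N) {p : ℝ} (hp : N + 1 < p)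
    (hp' : p < N + 2) :
    IntegrableOn (fun z : EuclideanSpace ℝ (Fin N) => ‖z‖ ^ 2 * ‖z‖ ^ (-p)) (ball 0 1) := by
  have : Nonempty (Fin N) := ⟨i⟩
  have hN : (1 : ℝ) ≤ N := by exact_mod_cast Fin.pos i
  simp_rw [norm_sq_mul_rpow_neg _ (show 2 < p by linarith)]
  exact integrableOn_ball_norm_rpow volume (by simp; linarith)

theorem abs_coord_le_norm (z : EuclideanSpace ℝ (Fin N)) (i : Fin N) : |z i| ≤ ‖z‖ := by
  simpa using PiLp.norm_apply_le z i

theorem integrableOn_ball_coord_sq_mul_rpow (i : Fin N) {p : ℝ} (hp : N + 1 < p)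
    (hp' : p < N + 2) :
    IntegrableOn (fun z : EuclideanSpace ℝ (Fin N) => z i ^ 2 * ‖z‖ ^ (-p)) (ball 0 1) := by
  refine (integrableOn_ball_norm_sq_mul_rpow i hp hp').mono' (by fun_prop) (.of_forall fun z => ?_)
  have h0 : 0 ≤ ‖z‖ ^ (-p) := rpow_nonneg (norm_nonneg z) _
  rw [norm_mul, norm_pow, norm_of_nonneg h0, norm_eq_abs]
  have := abs_coord_le_norm z i
  gcongr

theorem setIntegral_ball_coord_sq_mul_rpow (i : Fin N) {p : ℝ} (hp : N + 1 < p) (hp' : p < N + 2) :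
    ∫ z in ball (0 : EuclideanSpace ℝ (Fin N)) 1, z i ^ 2 * ‖z‖ ^ (-p) =
      volume.real (ball (0 : EuclideanSpace ℝ (Fin N)) 1) / (N + 2 - p) := by
  have hN : (N : ℝ) ≠ 0 := by exact_mod_cast (Fin.pos i).ne'
  have h := setIntegral_ball_norm_sq_mul_rpow i hp hp'
  simp_rw [EuclideanSpace.real_norm_sq_eq, Finset.sum_mul] at h
  rw [integral_finsetSum _ fun j _ => integrableOn_ball_coord_sq_mul_rpow j hp hp',
    Finset.sum_congr rfl fun j _ => setIntegral_ball_coord_sq_mul N j i fun r => r ^ (-p)] at h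
  simp only [Finset.sum_const, Finset.card_univ, Fintype.card_fin, nsmul_eq_mul] at h
  rw [mul_div_assoc] at h
  exact mul_left_cancel₀ hN h

theorem rpow_neg_le_add {x n α : ℝ} (hx : 0 ≤ x) (hn : 0 ≤ n) (h1 : 1 / 2 < α) (h2 : α < 1) :
    x ^ (-(n + 2 * α)) ≤ x ^ (-(n + 1)) + x ^ (-(n + 2)) := by
  rcases hx.eq_or_lt with rfl | hx
  · rw [zero_rpow (by linarith), zero_rpow (by linarith), zero_rpow (by linarith), add_zero]
  rcases le_total x 1 with h | h
  · have := rpow_le_rpow_of_exponent_ge hx h (show -(n + 2) ≤ -(n + 2 * α) by linarith)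
    have := rpow_nonneg hx.le (-(n + 1))
    linarith
  · have := rpow_le_rpow_of_exponent_le h (show -(n + 2 * α) ≤ -(n + 1) by linarith)
    have := rpow_nonneg hx.le (-(n + 2))
    linarith

theorem tendsto_mul_integral_div_norm_rpow (i : Fin N) {g : EuclideanSpace ℝ (Fin N) → ℝ}
    (hg : Measurable g) (a b : ℝ)
    (hint : Integrable fun z => (g z - (ball 0 1).indicator (fun z => a * ‖z‖ ^ 2 + b * z i ^ 2) z)
      * (‖z‖ ^ (-((N : ℝ) + 1)) + ‖z‖ ^ (-((N : ℝ) + 2)))) :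
    Tendsto (fun α : ℝ => (2 - 2 * α) * ∫ z, g z / ‖z‖ ^ ((N : ℝ) + 2 * α))
      (nhdsWithin 1 (Iio 1))
      (nhds ((a * N + b) * volume.real (ball (0 : EuclideanSpace ℝ (Fin N)) 1))) := by
  set h : EuclideanSpace ℝ (Fin N) → ℝ :=
    fun z => g z - (ball 0 1).indicator (fun z => a * ‖z‖ ^ 2 + b * z i ^ 2) z with h_def
  have hh : Measurable h := by
    refine hg.sub (Measurable.indicator ?_ measurableSet_ball)
    fun_prop
  set V := volume.real (ball (0 : EuclideanSpace ℝ (Fin N)) 1)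
  set M := ∫ z, |h z * (‖z‖ ^ (-((N : ℝ) + 1)) + ‖z‖ ^ (-((N : ℝ) + 2)))|
  have hev : ∀ᶠ α : ℝ in nhdsWithin 1 (Iio 1), 1 / 2 < α ∧ α < 1 :=
    (eventually_nhdsWithin_of_eventually_nhds (lt_mem_nhds (by norm_num))).and
      self_mem_nhdsWithin
  rw [tendsto_iff_norm_sub_tendsto_zero]
  have hlim : Tendsto (fun α : ℝ => (2 - 2 * α) * M) (nhdsWithin 1 (Iio 1)) (nhds 0) := by
    have : Continuous fun α : ℝ => (2 - 2 * α) * M := by fun_prop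
    simpa using (this.tendsto 1).mono_left nhdsWithin_le_nhds
  refine squeeze_zero' (.of_forall fun _ => norm_nonneg _) ?_ hlim
  filter_upwards [hev] with α ⟨h1, h2⟩
  have hbd : ∀ z, ‖h z * ‖z‖ ^ (-((N : ℝ) + 2 * α))‖ ≤
      |h z * (‖z‖ ^ (-((N : ℝ) + 1)) + ‖z‖ ^ (-((N : ℝ) + 2)))| := fun z => by
    rw [norm_mul, abs_mul, norm_eq_abs, norm_of_nonneg (rpow_nonneg (norm_nonneg z) _)]
    gcongr
    exact (rpow_neg_le_add (norm_nonneg z) N.cast_nonneg h1 h2).trans (le_abs_self _)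
  have hhi : Integrable fun z => h z * ‖z‖ ^ (-((N : ℝ) + 2 * α)) :=
    hint.abs.mono' (by fun_prop) (.of_forall hbd)
  have I1 := integrableOn_ball_norm_sq_mul_rpow i (p := (N : ℝ) + 2 * α) (by linarith) (by linarith)
  have I2 := integrableOn_ball_coord_sq_mul_rpow i (p := (N : ℝ) + 2 * α) (by linarith) (by linarith)
  have hsplit : ∀ z, g z / ‖z‖ ^ ((N : ℝ) + 2 * α) = (ball 0 1).indicator
      (fun z => a * (‖z‖ ^ 2 * ‖z‖ ^ (-((N : ℝ) + 2 * α)))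
        + b * (z i ^ 2 * ‖z‖ ^ (-((N : ℝ) + 2 * α)))) z + h z * ‖z‖ ^ (-((N : ℝ) + 2 * α)) := by
    intro z
    rw [rpow_neg (norm_nonneg z), div_eq_mul_inv, h_def]
    by_cases hz : z ∈ ball (0 : EuclideanSpace ℝ (Fin N)) 1
    · simp only [hz, indicator_of_mem, rpow_neg (norm_nonneg z)]; ring
    · simp [hz]
  have hR : ‖∫ z, h z * ‖z‖ ^ (-((N : ℝ) + 2 * α))‖ ≤ M :=
    norm_integral_le_of_norm_le hint.abs (.of_forall hbd)
  have key : (2 - 2 * α) * ∫ z, g z / ‖z‖ ^ ((N : ℝ) + 2 * α) =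
      (a * N + b) * V + (2 - 2 * α) * ∫ z, h z * ‖z‖ ^ (-((N : ℝ) + 2 * α)) := by
    simp_rw [hsplit]
    rw [integral_add _ hhi, integral_indicator measurableSet_ball,
      integral_add (I1.const_mul a) (I2.const_mul b), integral_const_mul, integral_const_mul,
      setIntegral_ball_norm_sq_mul_rpow i (by linarith) (by linarith),
      setIntegral_ball_coord_sq_mul_rpow i (by linarith) (by linarith)]
    · rw [show (N : ℝ) + 2 - (N + 2 * α) = 2 - 2 * α by ring]
      rw [mul_add]
      congr 1
      have hα' : 1 - α ≠ 0 := by linarith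
      simp only [V]
      field_simp
    · exact IntegrableOn.integrable_indicator ((I1.const_mul a).add (I2.const_mul b))
        measurableSet_ball
  rw [key, add_sub_cancel_left, norm_mul, norm_of_nonneg (by linarith)]
  gcongr
  linarith

theorem integrable_sub_indicator_mul (i : Fin N) {g : EuclideanSpace ℝ (Fin N) → ℝ}
    (hg : Measurable g) (a b : ℝ)
    (hO : (fun z => g z - (a * ‖z‖ ^ 2 + b * z i ^ 2)) =O[nhds 0] fun z => ‖z‖ ^ 3)
    (hgi : Integrable fun z => g z * (1 + ‖z‖) ^ (-((N : ℝ) + 1))) :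
    Integrable fun z => (g z - (ball 0 1).indicator (fun z => a * ‖z‖ ^ 2 + b * z i ^ 2) z)
      * (‖z‖ ^ (-((N : ℝ) + 1)) + ‖z‖ ^ (-((N : ℝ) + 2))) := by
  have hne : Nonempty (Fin N) := ⟨i⟩
  have hN : (1 : ℝ) ≤ N := by exact_mod_cast Fin.pos i
  obtain ⟨C, hC0, hC⟩ := hO.exists_nonneg
  obtain ⟨ε, hε, hεC⟩ := Metric.eventually_nhds_iff_ball.1 hC.bound
  set δ := min ε 1
  have hδ : 0 < δ := lt_min hε one_pos
  have hδ1 : δ ≤ 1 := min_le_right _ _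
  have hN0 : (0 : ℝ) ≤ (N : ℝ) + 1 := by positivity
  set A := (1 + δ⁻¹) ^ ((N : ℝ) + 1) * (1 + δ⁻¹)
  have hA : 0 ≤ A := by positivity
  have J1 : Integrable fun z : EuclideanSpace ℝ (Fin N) =>
      (ball (0 : EuclideanSpace ℝ (Fin N)) δ).indicator
        (fun z => 2 * C * ‖z‖ ^ (1 - (N : ℝ))) z :=
    IntegrableOn.integrable_indicator
      ((integrableOn_ball_norm_rpow volume (by simp)).const_mul _) measurableSet_ball
  have J2 : Integrable fun z : EuclideanSpace ℝ (Fin N) => (1 + ‖z‖) ^ (-((N : ℝ) + 1)) :=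
    integrable_one_add_norm (by simp)
  refine (J1.add ((hgi.norm.const_mul A).add (J2.const_mul (A * (|a| + |b|))))).mono' ?_
    (.of_forall fun z => ?_)
  · refine Measurable.aestronglyMeasurable (Measurable.mul (hg.sub
      (Measurable.indicator ?_ measurableSet_ball)) ?_) <;> fun_prop
  have hpos : 0 ≤ (1 + ‖z‖) ^ (-((N : ℝ) + 1)) := by positivity
  have hz0 := norm_nonneg z
  simp only [Pi.add_apply]
  by_cases hz : z ∈ ball (0 : EuclideanSpace ℝ (Fin N)) δ
  · have hzδ : ‖z‖ < δ := by simpa using hz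
    have hz1 : z ∈ ball (0 : EuclideanSpace ℝ (Fin N)) 1 := by simp; linarith
    have hb := hεC z (ball_subset_ball (min_le_left _ _) hz)
    rw [norm_pow, norm_norm] at hb
    simp only [hz, hz1, indicator_of_mem]
    have : ‖(g z - (a * ‖z‖ ^ 2 + b * z i ^ 2)) *
        (‖z‖ ^ (-((N : ℝ) + 1)) + ‖z‖ ^ (-((N : ℝ) + 2)))‖ ≤ 2 * C * ‖z‖ ^ (1 - (N : ℝ)) := by
      rw [norm_mul, norm_of_nonneg (r := _ + _) (by positivity)]
      rcases hz0.eq_or_lt with h | h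
      · rw [← h, zero_rpow (x := -_) (by linarith), zero_rpow (x := -_) (by linarith)]
        simp only [add_zero, mul_zero]
        positivity
      have e1 : ‖z‖ ^ 3 * ‖z‖ ^ (-((N : ℝ) + 2)) = ‖z‖ ^ (1 - (N : ℝ)) := by
        rw [← rpow_natCast, ← rpow_add h]; congr 1; push_cast; ring
      have e2 : ‖z‖ ^ (-((N : ℝ) + 1)) ≤ ‖z‖ ^ (-((N : ℝ) + 2)) :=
        rpow_le_rpow_of_exponent_ge h (by linarith) (by linarith)
      calc _ ≤ C * ‖z‖ ^ 3 * (‖z‖ ^ (-((N : ℝ) + 2)) + ‖z‖ ^ (-((N : ℝ) + 2))) := by gcongr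
        _ = 2 * C * (‖z‖ ^ 3 * ‖z‖ ^ (-((N : ℝ) + 2))) := by ring
        _ = _ := by rw [e1]
    have : 0 ≤ A * ‖g z * (1 + ‖z‖) ^ (-((N : ℝ) + 1))‖ +
      A * (|a| + |b|) * (1 + ‖z‖) ^ (-((N : ℝ) + 1)) := by positivity
    linarith
  · have hzδ : δ ≤ ‖z‖ := by simpa using hz
    have hzp : 0 < ‖z‖ := by linarith
    rw [indicator_of_notMem hz, zero_add]
    have hD : ‖z‖ ^ (-((N : ℝ) + 1)) + ‖z‖ ^ (-((N : ℝ) + 2)) ≤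
        A * (1 + ‖z‖) ^ (-((N : ℝ) + 1)) := by
      have e1 : ‖z‖⁻¹ ≤ δ⁻¹ := by gcongr
      have e2 : ‖z‖ ^ (-((N : ℝ) + 2)) = ‖z‖ ^ (-((N : ℝ) + 1)) * ‖z‖⁻¹ := by
        rw [← rpow_neg_one, ← rpow_add hzp]; congr 1; ring
      have e3 : 1 + ‖z‖ ≤ (1 + δ⁻¹) * ‖z‖ := by
        have : 1 ≤ δ⁻¹ * ‖z‖ := by rw [inv_mul_eq_div, one_le_div hδ]; exact hzδ
        linarith
      have e4 : ‖z‖ ^ (-((N : ℝ) + 1)) ≤ (1 + δ⁻¹) ^ ((N : ℝ) + 1) *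
          (1 + ‖z‖) ^ (-((N : ℝ) + 1)) := by
        rw [rpow_neg hz0, rpow_neg (by positivity), ← div_eq_mul_inv, le_div_iff₀ (by positivity),
          inv_mul_eq_div, div_le_iff₀ (by positivity), ← mul_rpow (by positivity) hz0]
        gcongr
      calc _ = ‖z‖ ^ (-((N : ℝ) + 1)) * (1 + ‖z‖⁻¹) := by rw [e2]; ring
        _ ≤ ((1 + δ⁻¹) ^ ((N : ℝ) + 1) * (1 + ‖z‖) ^ (-((N : ℝ) + 1))) * (1 + δ⁻¹) := by gcongr
        _ = _ := by ring
    have hind : |(ball 0 1).indicator (fun z => a * ‖z‖ ^ 2 + b * z i ^ 2) z| ≤ |a| + |b| := by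
      by_cases hz1 : z ∈ ball (0 : EuclideanSpace ℝ (Fin N)) 1
      · rw [indicator_of_mem hz1]
        have h1 : ‖z‖ ≤ 1 := by simp at hz1; exact hz1.le
        have h2 := (abs_coord_le_norm z i).trans h1
        refine (abs_add_le _ _).trans ?_
        rw [abs_mul, abs_mul, abs_pow, abs_pow, abs_norm]
        have h3 : ‖z‖ ^ 2 ≤ 1 := pow_le_one₀ hz0 h1
        have h4 : |z i| ^ 2 ≤ 1 := pow_le_one₀ (abs_nonneg _) h2
        nlinarith [abs_nonneg a, abs_nonneg b]
      · rw [indicator_of_notMem hz1, abs_zero]; positivity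
    rw [norm_mul, norm_of_nonneg (r := _ + _) (by positivity), norm_mul, norm_of_nonneg hpos]
    calc _ ≤ (‖g z‖ + (|a| + |b|)) * (A * (1 + ‖z‖) ^ (-((N : ℝ) + 1))) := by
          gcongr
          exact (norm_sub_le _ _).trans (by gcongr; exact hind)
      _ = _ := by ring

theorem one_sub_cos_coord_isBigO (i : Fin N) :
    (fun z : EuclideanSpace ℝ (Fin N) => (1 - cos (z i)) - (0 * ‖z‖ ^ 2 + 1 / 2 * z i ^ 2))
      =O[nhds 0] fun z => ‖z‖ ^ 3 := by
  refine Asymptotics.IsBigO.of_bound 1 ?_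
  filter_upwards [ball_mem_nhds 0 one_pos] with z hz
  have hz1 : ‖z‖ < 1 := by simpa using hz
  have h := abs_coord_le_norm z i
  have hc := cos_bound (h.trans hz1.le)
  rw [norm_eq_abs, norm_pow, norm_norm, one_mul, ← abs_neg]
  rw [show -(1 - cos (z i) - (0 * ‖z‖ ^ 2 + 1 / 2 * z i ^ 2))
    = cos (z i) - (1 - z i ^ 2 / 2) by ring]
  refine hc.trans ?_
  have h3 : |z i| ^ 3 ≤ ‖z‖ ^ 3 := by gcongr
  have h4 : |z i| ^ 4 ≤ |z i| ^ 3 :=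
    pow_le_pow_of_le_one (abs_nonneg _) (h.trans hz1.le) (by norm_num)
  have := pow_nonneg (abs_nonneg (z i)) 4
  linarith

theorem norm_add_smul_single_rpow (i : Fin N) {s : ℝ} (hs : s ^ 2 = 1) (σ : ℝ)
    (z : EuclideanSpace ℝ (Fin N)) :
    ‖z + s • EuclideanSpace.single i 1‖ ^ (-σ) = (1 + (2 * s * z i + ‖z‖ ^ 2)) ^ (-σ / 2) := by
  have h : ‖z + s • EuclideanSpace.single i (1 : ℝ)‖ ^ 2 = 1 + (2 * s * z i + ‖z‖ ^ 2) := by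
    rw [norm_add_sq_real, inner_smul_right, norm_smul, mul_pow, norm_eq_abs, sq_abs, hs]
    simp [EuclideanSpace.inner_single_right]
    ring
  rw [← h, ← rpow_natCast, ← rpow_mul (norm_nonneg _)]
  congr 1
  push_cast
  ring

theorem norm_add_smul_single_rpow_isBigO (i : Fin N) {s : ℝ} (hs : s ^ 2 = 1) (σ : ℝ) :
    (fun z : EuclideanSpace ℝ (Fin N) => ‖z + s • EuclideanSpace.single i 1‖ ^ (-σ) -
      (1 - σ * s * z i - σ / 2 * ‖z‖ ^ 2 + σ * (σ + 2) / 2 * z i ^ 2))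
      =O[nhds 0] fun z => ‖z‖ ^ 3 := by
  have hi : (fun z : EuclideanSpace ℝ (Fin N) => z i) =O[nhds 0] fun z => ‖z‖ :=
    .of_norm_le fun z => by simpa using abs_coord_le_norm z i
  have hn : (fun z : EuclideanSpace ℝ (Fin N) => ‖z‖) =O[nhds 0] fun _ => (1 : ℝ) :=
    Continuous.tendsto (by fun_prop) 0 |>.isBigO_one ℝ
  have hn2 : (fun z : EuclideanSpace ℝ (Fin N) => ‖z‖ ^ 2) =O[nhds 0] fun z => ‖z‖ := by
    simpa [sq] using (Asymptotics.isBigO_refl (fun z : EuclideanSpace ℝ (Fin N) => ‖z‖) _).mul hn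
  have ht : (fun z : EuclideanSpace ℝ (Fin N) => 2 * s * z i + ‖z‖ ^ 2) =O[nhds 0]
      fun z => ‖z‖ := (hi.const_mul_left _).add hn2
  have ht0 : Tendsto (fun z : EuclideanSpace ℝ (Fin N) => 2 * s * z i + ‖z‖ ^ 2) (nhds 0)
      (nhds 0) := by
    have : Continuous fun z : EuclideanSpace ℝ (Fin N) => 2 * s * z i + ‖z‖ ^ 2 := by fun_prop
    simpa using this.tendsto 0
  have hT := ((rpow_one_add_sub_taylor_isBigO (-σ / 2)).comp_tendsto ht0).trans
    ((ht.norm_left.pow 3).congr_left fun z => by simp)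
  have hrest : (fun z : EuclideanSpace ℝ (Fin N) => σ * (σ + 2) / 8 *
      (4 * s * (z i * ‖z‖ ^ 2) + ‖z‖ ^ 2 * ‖z‖ ^ 2)) =O[nhds 0] fun z => ‖z‖ ^ 3 := by
    have r := Asymptotics.isBigO_refl (fun z : EuclideanSpace ℝ (Fin N) => ‖z‖ ^ 2) (nhds 0)
    refine .const_mul_left (.add (.const_mul_left ?_ _) ?_) _
    · exact (hi.mul r).congr_right fun z => by ring
    · exact (hn2.mul r).congr_right fun z => by ring
  refine (hT.add hrest).congr_left fun z => ?_
  simp only [Function.comp_apply, norm_add_smul_single_rpow i hs]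
  linear_combination -(σ * (σ + 2) / 2 * z i ^ 2) * hs

theorem integrable_norm_add_rpow_mul {σ : ℝ} (h0 : 0 < σ) (hσ : σ < N)
    (e : EuclideanSpace ℝ (Fin N)) :
    Integrable fun z : EuclideanSpace ℝ (Fin N) =>
      ‖z + e‖ ^ (-σ) * (1 + ‖z‖) ^ (-((N : ℝ) + 1)) := by
  have hN : 0 < N := by exact_mod_cast h0.trans hσ
  have : Nonempty (Fin N) := ⟨⟨0, hN⟩⟩
  have J1 : Integrable fun z : EuclideanSpace ℝ (Fin N) =>
      (ball (0 : EuclideanSpace ℝ (Fin N)) 1).indicator (fun z => ‖z‖ ^ (-σ)) (z + e) :=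
    (IntegrableOn.integrable_indicator
      (integrableOn_ball_norm_rpow volume (by simpa using hσ)) measurableSet_ball).comp_add_right e
  have J2 : Integrable fun z : EuclideanSpace ℝ (Fin N) => (1 + ‖z‖) ^ (-((N : ℝ) + 1)) :=
    integrable_one_add_norm (by simp)
  refine (J1.add J2).mono' (Measurable.aestronglyMeasurable (by fun_prop))
    (.of_forall fun z => ?_)
  have hpos : 0 ≤ (1 + ‖z‖) ^ (-((N : ℝ) + 1)) := by positivity
  have hpos' : 0 ≤ ‖z + e‖ ^ (-σ) := by positivity
  have hle : (1 + ‖z‖) ^ (-((N : ℝ) + 1)) ≤ 1 :=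
    rpow_le_one_of_one_le_of_nonpos (by linarith [norm_nonneg z])
      (by linarith [N.cast_nonneg (α := ℝ)])
  rw [norm_of_nonneg (by positivity), Pi.add_apply]
  by_cases hz : z + e ∈ ball (0 : EuclideanSpace ℝ (Fin N)) 1
  · rw [indicator_of_mem hz]
    nlinarith
  · rw [indicator_of_notMem hz]
    have : ‖z + e‖ ^ (-σ) ≤ 1 :=
      rpow_le_one_of_one_le_of_nonpos (by simpa using hz) (by linarith)
    nlinarith
end

theorem stmt6 (N : ℕ) (hN : 3 ≤ N) (σ : ℝ) (hσ : σ ∈ Set.Ioo (0:ℝ) (N:ℝ))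
    (eN : EuclideanSpace ℝ (Fin N)) (heN : eN = EuclideanSpace.single ⟨N - 1, by omega⟩ 1) :
    Tendsto
      (fun α : ℝ =>
        (∫ z : EuclideanSpace ℝ (Fin N),
            (1 - Real.cos (z ⟨0, by omega⟩)) / ‖z‖ ^ ((N : ℝ) + 2 * α))⁻¹ *
          (-(1/2) * ∫ z : EuclideanSpace ℝ (Fin N),
            (‖z + eN‖ ^ (-σ) + ‖z - eN‖ ^ (-σ) - 2) / ‖z‖ ^ ((N : ℝ) + 2 * α)))
      (nhdsWithin 1 (Set.Iio 1))
      (nhds (((N : ℝ) - 2 - σ) * σ)) := by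
  have hN0 : 0 < N := by omega
  set i : Fin N := ⟨N - 1, by omega⟩
  set V := volume.real (ball (0 : EuclideanSpace ℝ (Fin N)) 1)
  have hV : V ≠ 0 := (ENNReal.toReal_pos (measure_ball_pos _ _ one_pos).ne'
    measure_ball_lt_top.ne).ne'
  have J2 : Integrable fun z : EuclideanSpace ℝ (Fin N) => (1 + ‖z‖) ^ (-((N : ℝ) + 1)) :=
    integrable_one_add_norm (by simp)
  have hcos : Measurable fun z : EuclideanSpace ℝ (Fin N) => 1 - cos (z ⟨0, hN0⟩) := by fun_prop
  have H1 := tendsto_mul_integral_div_norm_rpow _ hcos 0 (1 / 2)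
    (integrable_sub_indicator_mul _ hcos _ _ (one_sub_cos_coord_isBigO _) (by
      refine (J2.const_mul 2).mono' (Measurable.aestronglyMeasurable (by fun_prop))
        (.of_forall fun z => ?_)
      rw [norm_mul, norm_of_nonneg (r := _ ^ _) (by positivity)]
      gcongr
      rw [norm_eq_abs, abs_le]
      constructor <;> linarith [cos_le_one (z ⟨0, hN0⟩), neg_one_le_cos (z ⟨0, hN0⟩)]))
  have hpow : Measurable fun z : EuclideanSpace ℝ (Fin N) =>
      ‖z + eN‖ ^ (-σ) + ‖z - eN‖ ^ (-σ) - 2 := by fun_prop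
  have H2 := tendsto_mul_integral_div_norm_rpow i hpow (-σ) (σ * (σ + 2))
    (integrable_sub_indicator_mul i hpow _ _ (by
      refine ((norm_add_smul_single_rpow_isBigO i (s := 1) (by norm_num) σ).add
        (norm_add_smul_single_rpow_isBigO i (s := -1) (by norm_num) σ)).congr_left fun z => ?_
      rw [← heN, one_smul, neg_one_smul, ← sub_eq_add_neg]
      ring) (by
      have K1 := integrable_norm_add_rpow_mul hσ.1 hσ.2 eN
      have K2 := integrable_norm_add_rpow_mul hσ.1 hσ.2 (-eN)
      refine ((K1.add K2).sub (J2.const_mul 2)).congr (.of_forall fun z => ?_)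
      simp only [Pi.add_apply, Pi.sub_apply, ← sub_eq_add_neg]
      ring))
  have H := (H1.inv₀ (by rw [zero_mul, zero_add]; positivity)).mul (H2.const_mul (-(1 / 2)))
  have hlim : ((0 * (N : ℝ) + 1 / 2) * V)⁻¹ * (-(1 / 2) * ((-σ * N + σ * (σ + 2)) * V)) =
      ((N : ℝ) - 2 - σ) * σ := by
    field_simp
    ring
  rw [hlim] at H
  refine H.congr' ?_
  filter_upwards [self_mem_nhdsWithin] with α (hα : α < 1)
  have h : 1 - α ≠ 0 := by linarith
  field_simp
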